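/- arXiv:1702.01018 — 9 statements merged into one kernel-verified Lean document; each statement's English description precedes it below -/
import Mathlib

section
/- Let V be a finite type, let 𝒞 : Finset (Finset V) be a laminar family (any two members C, C' of 𝒞 satisfy C ∩ C' = ∅ or C ⊆ C' or C' ⊆ C), and let t : ℕ. Suppose there exists S ⊆ 𝒞 with |⋃ S| ≥ t, where ⋃ S denotes the union of the members of S. Then there exists S* ⊆ 𝒞 whose members are pairwise disjoint, with |⋃ S*| ≥ t, such that for every S ⊆ 𝒞 with |⋃ S| ≥ t one has S*.card ≤ S.card. That is, the minimum number of members of a laminar family needed to cover at least t elements is attained by a pairwise disjoint subfamily. -/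
/-- Erasing a member contained in another member does not change the union. -/
theorem Finset.biUnion_id_erase_of_subset {V : Type*} [DecidableEq V] {S : Finset (Finset V)}
    {C C' : Finset V} (hC' : C' ∈ S) (hne : C ≠ C') (hsub : C ⊆ C') :
    (S.erase C).biUnion id = S.biUnion id := by
  refine (Finset.biUnion_subset_biUnion_of_subset_left _ (S.erase_subset C)).antisymm ?_
  refine Finset.biUnion_subset.2 fun D hD => ?_
  by_cases h : D = C
  · subst h
    exact hsub.trans (Finset.subset_biUnion_of_mem id (Finset.mem_erase.2 ⟨hne.symm, hC'⟩))
  · exact Finset.subset_biUnion_of_mem id (Finset.mem_erase.2 ⟨h, hD⟩)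

/-- The minimum number of members of a laminar family needed to cover at least `t`
elements is attained by a pairwise disjoint subfamily. -/
theorem laminar_min_cover_disjoint {V : Type*} [Fintype V] [DecidableEq V]
    (𝒞 : Finset (Finset V))
    (hlam : ∀ C ∈ 𝒞, ∀ C' ∈ 𝒞, C ∩ C' = ∅ ∨ C ⊆ C' ∨ C' ⊆ C) (t : ℕ)
    (hex : ∃ S ⊆ 𝒞, t ≤ (S.biUnion id).card) :
    ∃ Sstar ⊆ 𝒞, (∀ C ∈ Sstar, ∀ C' ∈ Sstar, C ≠ C' → C ∩ C' = ∅) ∧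
      t ≤ (Sstar.biUnion id).card ∧
      ∀ S ⊆ 𝒞, t ≤ (S.biUnion id).card → Sstar.card ≤ S.card := by
  obtain ⟨S, ⟨hS𝒞, hSt⟩, hmin⟩ := exists_minimalFor_of_wellFoundedLT
    (fun S : Finset (Finset V) => S ⊆ 𝒞 ∧ t ≤ (S.biUnion id).card) Finset.card hex
  have hcard : ∀ T ⊆ 𝒞, t ≤ (T.biUnion id).card → S.card ≤ T.card := fun T hT hTt =>
    (le_total S.card T.card).elim id (hmin ⟨hT, hTt⟩)
  have hanti : ∀ C ∈ S, ∀ C' ∈ S, C ≠ C' → ¬ C ⊆ C' := by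
    intro C hC C' hC' hne hsub
    refine (Finset.card_erase_lt_of_mem hC).not_ge
      (hcard _ ((S.erase_subset C).trans hS𝒞) ?_)
    rwa [Finset.biUnion_id_erase_of_subset hC' hne hsub]
  refine ⟨S, hS𝒞, fun C hC C' hC' hne => ?_, hSt, hcard⟩
  exact (hlam C (hS𝒞 hC) C' (hS𝒞 hC')).resolve_right
    (not_or.2 ⟨hanti C hC C' hC' hne, hanti C' hC' C hC hne.symm⟩)
end

section
/- Let V be a finite type and R : V → V → Prop a partial-functional relation (for all z, y₁, y₂: R z y₁ → R z y₂ → y₁ = y₂). For I ⊆ V let fail(I) be the least set F with I ⊆ F closed under propagation (R z y and y ∈ F imply z ∈ F), and write C(x) = fail({x}). Let t : ℕ with t ≤ Fintype.card V. Then there exists a finite set I* ⊆ V such that |fail(I*)| ≥ t, the kill sets C(x) for distinct x ∈ I* are pairwise disjoint, and for every finite I ⊆ V with |fail(I)| ≥ t one has I*.card ≤ I.card. In other words, the minimum number of entities whose initial failure causes at least t final failures is achieved by an initial set whose kill sets are pairwise disjoint. -/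
/-- The cascading failure set of an initial failure set `I`: the least set containing `I`
closed under propagation along the dependency relation `R`. -/
def cascFail {V : Type*} (R : V → V → Prop) (I : Set V) : Set V :=
  ⋂₀ {F : Set V | I ⊆ F ∧ ∀ z y, R z y → y ∈ F → z ∈ F}

theorem mem_cascFail_iff {V : Type*} {R : V → V → Prop} {I : Set V} {z : V} :
    z ∈ cascFail R I ↔ ∃ x ∈ I, Relation.ReflTransGen R z x := by
  constructor
  · intro hz
    refine hz {w | ∃ x ∈ I, Relation.ReflTransGen R w x} ⟨fun x hx => ⟨x, hx, .refl⟩, ?_⟩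
    rintro w y hwy ⟨x, hx, hyx⟩
    exact ⟨x, hx, .head hwy hyx⟩
  · rintro ⟨x, hx, hzx⟩ F ⟨hIF, hF⟩
    induction hzx using Relation.ReflTransGen.head_induction_on with
    | refl => exact hIF hx
    | head h _ ih => exact hF _ _ h ih

/-- An entity that fails as a consequence of another initial failure is redundant. -/
theorem cascFail_subset_cascFail_diff_singleton {V : Type*} {R : V → V → Prop} {I : Set V}
    {x y : V} (hy : y ∈ I) (hxy : x ≠ y) (h : Relation.ReflTransGen R x y) :
    cascFail R I ⊆ cascFail R (I \ {x}) := by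
  intro z hz
  obtain ⟨w, hw, hzw⟩ := mem_cascFail_iff.1 hz
  rw [mem_cascFail_iff]
  by_cases hwx : w = x
  · subst hwx
    exact ⟨y, ⟨hy, hxy.symm⟩, hzw.trans h⟩
  · exact ⟨w, ⟨hw, hwx⟩, hzw⟩

/-- In Case I (partial-functional dependencies), the minimum number of entities whose
initial failure causes at least `t` final failures is achieved by an initial set whose
kill sets are pairwise disjoint. -/
theorem caseI_optimal_disjoint_killsets {V : Type*} [Fintype V] (R : V → V → Prop)
    (hR : ∀ z y₁ y₂, R z y₁ → R z y₂ → y₁ = y₂) (t : ℕ) (ht : t ≤ Fintype.card V) :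
    ∃ Istar : Finset V, t ≤ (cascFail R ↑Istar).ncard ∧
      (∀ x ∈ Istar, ∀ y ∈ Istar, x ≠ y → cascFail R {x} ∩ cascFail R {y} = ∅) ∧
      ∀ I : Finset V, t ≤ (cascFail R ↑I).ncard → Istar.card ≤ I.card := by
  classical
  have hne : (Finset.univ.filter fun I : Finset V => t ≤ (cascFail R ↑I).ncard).Nonempty := by
    refine ⟨Finset.univ, Finset.mem_filter.2 ⟨Finset.mem_univ _, ?_⟩⟩
    have huniv : cascFail R ((Finset.univ : Finset V) : Set V) = Set.univ :=
      Set.eq_univ_of_forall fun z => mem_cascFail_iff.2 ⟨z, by simp, .refl⟩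
    rwa [huniv, Set.ncard_univ, Nat.card_eq_fintype_card]
  obtain ⟨I, hI, hmin⟩ := Finset.exists_min_image _ Finset.card hne
  have hIt := (Finset.mem_filter.1 hI).2
  have hmin' : ∀ J : Finset V, t ≤ (cascFail R ↑J).ncard → I.card ≤ J.card :=
    fun J hJ => hmin J (Finset.mem_filter.2 ⟨Finset.mem_univ _, hJ⟩)
  have irredundant : ∀ x ∈ I, ∀ y ∈ I, x ≠ y → ¬ Relation.ReflTransGen R x y := by
    intro x hx y hy hxy h
    have hsub := cascFail_subset_cascFail_diff_singleton (Finset.mem_coe.2 hy) hxy h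
    rw [← Finset.coe_erase] at hsub
    exact (Finset.card_erase_lt_of_mem hx).not_ge
      (hmin' _ (hIt.trans (Set.ncard_le_ncard hsub (Set.toFinite _))))
  refine ⟨I, hIt, fun x hx y hy hxy => ?_, hmin'⟩
  rw [Set.eq_empty_iff_forall_notMem]
  rintro z ⟨hzx, hzy⟩
  simp only [mem_cascFail_iff, Set.mem_singleton_iff, exists_eq_left] at hzx hzy
  have hU : Relator.RightUnique R := fun z y₁ y₂ h₁ h₂ => hR z y₁ y₂ h₁ h₂
  rcases Relation.ReflTransGen.total_of_right_unique hU hzx hzy with h | h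
  · exact irredundant _ hx _ hy hxy h
  · exact irredundant _ hy _ hx hxy.symm h
end

section
/- Let E be a finite type, n M : ℕ, and 𝒮 : Fin n → Finset E. For I : Finset (E ⊕ Fin n) define the final failure set F(I) = I ∪ {Sum.inr i | ∃ e ∈ 𝒮 i, Sum.inl e ∈ I}. If H : Finset E satisfies H.card = M and H hits every subset (for every i : Fin n there exists e ∈ H with e ∈ 𝒮 i), then the initial failure set I = H.image Sum.inl satisfies I.card = M and (F(I)).card = M + n. -/
/-- Final failure set of the Case II network built from a Hitting Set instance:
the initial failures together with every `a_i` some of whose minterm entities failed. -/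
def caseIIFail {E : Type*} [DecidableEq E] {n : ℕ} (𝒮 : Fin n → Finset E)
    (I : Finset (E ⊕ Fin n)) : Finset (E ⊕ Fin n) :=
  I ∪ (Finset.univ.filter (fun i : Fin n => ∃ e ∈ 𝒮 i, Sum.inl e ∈ I)).image Sum.inr

/-- Forward direction of the reduction in Theorem 2: a hitting set of size `M` yields an
initial failure set of size `M` whose final failure set has size `M + n`. -/
theorem hittingSet_to_failure {E : Type*} [Fintype E] [DecidableEq E] (n M : ℕ)
    (𝒮 : Fin n → Finset E) (H : Finset E) (hcard : H.card = M)
    (hhit : ∀ i : Fin n, ∃ e ∈ H, e ∈ 𝒮 i) :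
    (H.image (Sum.inl : E → E ⊕ Fin n)).card = M ∧
    (caseIIFail 𝒮 (H.image (Sum.inl : E → E ⊕ Fin n))).card = M + n := by
  have hfail : (Finset.univ.filter (fun i : Fin n => ∃ e ∈ 𝒮 i,
      (Sum.inl e : E ⊕ Fin n) ∈ H.image (Sum.inl : E → E ⊕ Fin n))) = Finset.univ := by
    refine Finset.filter_true_of_mem fun i _ => ?_
    obtain ⟨e, heH, heS⟩ := hhit i
    exact ⟨e, heS, Finset.mem_image_of_mem _ heH⟩
  have hinl : (H.image (Sum.inl : E → E ⊕ Fin n)).card = M := by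
    rw [Finset.card_image_of_injective _ Sum.inl_injective, hcard]
  refine ⟨hinl, ?_⟩
  rw [caseIIFail, hfail, Finset.card_union_of_disjoint, hinl,
    Finset.card_image_of_injective _ Sum.inr_injective, Finset.card_univ, Fintype.card_fin]
  simp [Finset.disjoint_left]
end

section
/- Let E be a finite type, n M : ℕ, and 𝒮 : Fin n → Finset E. For I : Finset (E ⊕ Fin n) define the final failure set F(I) = I ∪ {Sum.inr i | ∃ e ∈ 𝒮 i, Sum.inl e ∈ I}. If I : Finset (E ⊕ Fin n) satisfies I.card ≤ M and (F(I)).card ≥ M + n, then the set H = {e : E | Sum.inl e ∈ I} satisfies H.card ≤ M and H hits every subset: for every i : Fin n there exists e ∈ H with e ∈ 𝒮 i. (Moreover I contains no entity of the form Sum.inr i and H.card = M.) -/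
/-- Backward direction of the reduction in Theorem 2: an initial failure set of size at
most `M` failing at least `M + n` entities yields a hitting set of size at most `M`;
moreover `I` contains no `a`-type entity and the hitting set has size exactly `M`. -/
theorem failure_to_hittingSet {E : Type*} [Fintype E] [DecidableEq E] (n M : ℕ)
    (𝒮 : Fin n → Finset E) (I : Finset (E ⊕ Fin n)) (hI : I.card ≤ M)
    (hF : M + n ≤ (caseIIFail 𝒮 I).card) :
    (Finset.univ.filter (fun e : E => Sum.inl e ∈ I)).card ≤ M ∧
    (∀ i : Fin n, ∃ e ∈ Finset.univ.filter (fun e : E => Sum.inl e ∈ I), e ∈ 𝒮 i) ∧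
    (∀ i : Fin n, Sum.inr i ∉ I) ∧
    (Finset.univ.filter (fun e : E => Sum.inl e ∈ I)).card = M := by
  set T := Finset.univ.filter (fun i : Fin n => ∃ e ∈ 𝒮 i, Sum.inl e ∈ I) with hT
  have hunion : (caseIIFail 𝒮 I).card + (I ∩ T.image Sum.inr).card
      = I.card + (T.image Sum.inr).card := Finset.card_union_add_card_inter _ _
  have himage : (T.image (Sum.inr : Fin n → E ⊕ Fin n)).card = T.card :=
    Finset.card_image_of_injective _ Sum.inr_injective
  have hTn : T.card ≤ n := by simpa using Finset.card_le_univ T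
  have hTuniv : T = Finset.univ := by
    rw [← Finset.card_eq_iff_eq_univ, Fintype.card_fin]
    omega
  have hhit (i : Fin n) : ∃ e ∈ 𝒮 i, Sum.inl e ∈ I := by
    have hi : i ∈ T := hTuniv ▸ Finset.mem_univ i
    simpa [hT] using hi
  have hdisj : I ∩ T.image Sum.inr = ∅ := by
    rw [← Finset.card_eq_zero]
    omega
  have hinr (i : Fin n) : Sum.inr i ∉ I := fun hi => by
    have hmem : Sum.inr i ∈ I ∩ T.image Sum.inr := by simp [hi, hTuniv]
    simp [hdisj] at hmem
  have hIinl : I = (Finset.univ.filter (fun e : E => Sum.inl e ∈ I)).image Sum.inl := by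
    ext (e | i)
    · simp
    · simp [hinr i]
  have hcard : (Finset.univ.filter (fun e : E => Sum.inl e ∈ I)).card = M := by
    rw [← Finset.card_image_of_injective _ (Sum.inl_injective (β := Fin n)), ← hIinl]
    omega
  refine ⟨hcard.le, fun i => ?_, hinr, hcard⟩
  obtain ⟨e, he, heI⟩ := hhit i
  exact ⟨e, by simpa using heI, he⟩
end

section
/- Let E be a finite type, n M : ℕ with M ≤ Fintype.card E, and 𝒮 : Fin n → Finset E. For I : Finset (E ⊕ Fin n) define F(I) = I ∪ {Sum.inr i | ∃ e ∈ 𝒮 i, Sum.inl e ∈ I}. Then the following are equivalent: (1) there exists I : Finset (E ⊕ Fin n) with I.card ≤ M and (F(I)).card ≥ M + n; (2) there exists H : Finset E with H.card ≤ M such that for every i : Fin n there exists e ∈ H with e ∈ 𝒮 i. -/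
/-- Correctness of the reduction of Theorem 2: the Case II RIDN instance has a solution
iff the Hitting Set instance has a solution. -/
theorem caseII_reduction_correct {E : Type*} [Fintype E] [DecidableEq E] (n M : ℕ)
    (hM : M ≤ Fintype.card E) (𝒮 : Fin n → Finset E) :
    (∃ I : Finset (E ⊕ Fin n), I.card ≤ M ∧ M + n ≤ (caseIIFail 𝒮 I).card) ↔
    (∃ H : Finset E, H.card ≤ M ∧ ∀ i : Fin n, ∃ e ∈ H, e ∈ 𝒮 i) := by
  constructor
  · rintro ⟨I, hI, hF⟩
    refine ⟨I.toLeft, Finset.card_toLeft_le.trans hI, ?_⟩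
    have hunion := Finset.card_union_le I
      ((Finset.univ.filter (fun i : Fin n => ∃ e ∈ 𝒮 i, Sum.inl e ∈ I)).image Sum.inr)
    rw [Finset.card_image_of_injective _ Sum.inr_injective] at hunion
    have hfilter : (Finset.univ.filter (fun i : Fin n => ∃ e ∈ 𝒮 i, Sum.inl e ∈ I)) =
        Finset.univ := by
      apply Finset.eq_univ_of_card
      apply le_antisymm (Finset.card_le_univ _)
      rw [Fintype.card_fin]
      unfold caseIIFail at hF
      omega
    intro i
    obtain ⟨e, he, heI⟩ := (Finset.mem_filter.mp (hfilter ▸ Finset.mem_univ i)).2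
    exact ⟨e, Finset.mem_toLeft.mpr heI, he⟩
  · rintro ⟨H, hH, hit⟩
    obtain ⟨K, hHK, hK⟩ := Finset.exists_superset_card_eq hH hM
    refine ⟨K.image Sum.inl, Finset.card_image_le.trans hK.le, ?_⟩
    have hfilter : (Finset.univ.filter
        (fun i : Fin n => ∃ e ∈ 𝒮 i, (Sum.inl e : E ⊕ Fin n) ∈ K.image Sum.inl)) =
        Finset.univ := by
      refine Finset.filter_true_of_mem fun i _ => ?_
      obtain ⟨e, heH, he⟩ := hit i
      exact ⟨e, he, Finset.mem_image_of_mem _ (hHK heH)⟩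
    have hdisj : Disjoint (K.image (Sum.inl : E → E ⊕ Fin n))
        ((Finset.univ : Finset (Fin n)).image Sum.inr) := by
      simp [Finset.disjoint_left]
    rw [caseIIFail, hfilter, Finset.card_union_of_disjoint hdisj,
      Finset.card_image_of_injective _ Sum.inl_injective,
      Finset.card_image_of_injective _ Sum.inr_injective, hK, Finset.card_fin]
end

section
/- Let E be a finite type, n : ℕ, and 𝒮 : Fin n → Finset E with 𝒮 i nonempty for every i. For I : Finset (E ⊕ Fin n) define F(I) = I ∪ {Sum.inr i | ∃ e ∈ 𝒮 i, Sum.inl e ∈ I}. Then for every I : Finset (E ⊕ Fin n) there exists H : Finset E such that the initial set I' = H.image Sum.inl satisfies I'.card ≤ I.card and (F(I')).card ≥ (F(I)).card. That is, an initial failure set consisting only of b-type (element) entities is always at least as effective. -/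
/-- In the Case II reduction, an initial failure set consisting only of `b`-type
(element) entities is always at least as effective. -/
theorem caseII_bType_suffices {E : Type*} [Fintype E] [DecidableEq E] (n : ℕ)
    (𝒮 : Fin n → Finset E) (h𝒮 : ∀ i : Fin n, (𝒮 i).Nonempty)
    (I : Finset (E ⊕ Fin n)) :
    ∃ H : Finset E, (H.image (Sum.inl : E → E ⊕ Fin n)).card ≤ I.card ∧
      (caseIIFail 𝒮 I).card ≤ (caseIIFail 𝒮 (H.image Sum.inl)).card := by
  choose e he using h𝒮
  refine ⟨I.image (Sum.elim id e), Finset.card_image_le.trans Finset.card_image_le,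
    Finset.card_le_card ?_⟩
  have h_left {b : E} (hb : Sum.inl b ∈ I) : b ∈ I.image (Sum.elim id e) :=
    Finset.mem_image.2 ⟨_, hb, rfl⟩
  have h_right {i : Fin n} (hi : Sum.inr i ∈ I) : e i ∈ I.image (Sum.elim id e) :=
    Finset.mem_image.2 ⟨_, hi, rfl⟩
  have h_hit {i : Fin n} {b : E} (hbi : b ∈ 𝒮 i) (hb : b ∈ I.image (Sum.elim id e)) :
      Sum.inr i ∈ caseIIFail 𝒮 ((I.image (Sum.elim id e)).image Sum.inl) :=
    Finset.mem_union_right _ <| Finset.mem_image_of_mem _ <|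
      Finset.mem_filter.2 ⟨Finset.mem_univ i, b, hbi, Finset.mem_image_of_mem _ hb⟩
  intro x hx
  rcases Finset.mem_union.1 hx with hx | hx
  · rcases x with b | i
    · exact Finset.mem_union_left _ (Finset.mem_image_of_mem _ (h_left hx))
    · exact h_hit (he i) (h_right hx)
  · obtain ⟨i, hi, rfl⟩ := Finset.mem_image.1 hx
    obtain ⟨-, b, hbi, hb⟩ := Finset.mem_filter.1 hi
    exact h_hit hbi (h_left hb)
end

section
/- Let V be a finite type, n M p : ℕ, and e : Fin n → Finset V. For I : Finset (V ⊕ Fin n) define the final failure set F(I) = I ∪ {Sum.inr j | ∀ v ∈ e j, Sum.inl v ∈ I}. If I : Finset (V ⊕ Fin n) satisfies I.card ≤ p and (F(I)).card ≥ p + M, then the set V' = {v : V | Sum.inl v ∈ I} satisfies V'.card ≤ p and the number of indices j : Fin n with e j ⊆ V' is at least M. -/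
/-- Final failure set of the Case III network built from a Densest p-Subhypergraph
instance. -/
def caseIIIFail {V : Type*} [DecidableEq V] {n : ℕ} (e : Fin n → Finset V)
    (I : Finset (V ⊕ Fin n)) : Finset (V ⊕ Fin n) :=
  I ∪ (Finset.univ.filter (fun j : Fin n => ∀ v ∈ e j, Sum.inl v ∈ I)).image Sum.inr

/-- Backward direction of the reduction in Theorem 3: an initial failure set of size at
most `p` failing at least `p + M` entities yields a vertex set of size at most `p`
covering at least `M` hyperedges. -/
theorem failure_to_denseSubhypergraph {V : Type*} [Fintype V] [DecidableEq V]
    (n M p : ℕ) (e : Fin n → Finset V) (I : Finset (V ⊕ Fin n)) (hI : I.card ≤ p)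
    (hF : p + M ≤ (caseIIIFail e I).card) :
    (Finset.univ.filter (fun v : V => Sum.inl v ∈ I)).card ≤ p ∧
    M ≤ (Finset.univ.filter
      (fun j : Fin n => e j ⊆ Finset.univ.filter (fun v : V => Sum.inl v ∈ I))).card := by
  refine ⟨(Finset.card_le_card_of_injOn Sum.inl (fun v hv => by simpa using hv)
    Sum.inl_injective.injOn).trans hI, ?_⟩
  simp only [Finset.subset_iff, Finset.mem_filter_univ]
  have h_union := hF.trans (Finset.card_union_le _ _)
  have h_image := h_union.trans (Nat.add_le_add_left Finset.card_image_le I.card)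
  convert Nat.add_le_add_iff_left.mp (h_image.trans (Nat.add_le_add_right hI _))
end

section
/- Let V be a finite type, n M p : ℕ with p ≤ Fintype.card V, and e : Fin n → Finset V. For I : Finset (V ⊕ Fin n) define F(I) = I ∪ {Sum.inr j | ∀ v ∈ e j, Sum.inl v ∈ I}. Then the following are equivalent: (1) there exists I : Finset (V ⊕ Fin n) with I.card ≤ p and (F(I)).card ≥ p + M; (2) there exists V' : Finset V with V'.card ≤ p such that the number of indices j : Fin n with e j ⊆ V' is at least M. -/
/-- Correctness of the reduction of Theorem 3: the Case III RIDN instance has a solution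
iff the Densest p-Subhypergraph instance has a solution. -/
theorem caseIII_reduction_correct {V : Type*} [Fintype V] [DecidableEq V]
    (n M p : ℕ) (hp : p ≤ Fintype.card V) (e : Fin n → Finset V) :
    (∃ I : Finset (V ⊕ Fin n), I.card ≤ p ∧ p + M ≤ (caseIIIFail e I).card) ↔
    (∃ V' : Finset V, V'.card ≤ p ∧
      M ≤ (Finset.univ.filter (fun j : Fin n => e j ⊆ V')).card) := by
  constructor
  · rintro ⟨I, hI, hF⟩
    refine ⟨I.toLeft, I.card_toLeft_le.trans hI, ?_⟩
    have hunion : (caseIIIFail e I).card ≤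
        I.card + (Finset.univ.filter fun j : Fin n => e j ⊆ I.toLeft).card := by
      refine (Finset.card_union_le _ _).trans (Nat.add_le_add_left ?_ _)
      refine Finset.card_image_le.trans (Finset.card_le_card fun j hj => ?_)
      simpa [Finset.subset_iff] using hj
    omega
  · rintro ⟨V', hV', hM⟩
    obtain ⟨W, hVW, hW⟩ := Finset.exists_superset_card_eq hV' hp
    have hcard : (W.image (Sum.inl : V → V ⊕ Fin n)).card = p := by
      rw [Finset.card_image_of_injective _ Sum.inl_injective, hW]
    refine ⟨W.image Sum.inl, hcard.le, ?_⟩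
    unfold caseIIIFail
    rw [Finset.card_union_of_disjoint, hcard,
      Finset.card_image_of_injective _ Sum.inr_injective]
    · refine Nat.add_le_add_left (hM.trans (Finset.card_le_card fun j hj => ?_)) p
      simp only [Finset.mem_filter, Finset.mem_univ, true_and] at hj ⊢
      exact fun v hv => Finset.mem_image_of_mem _ (hVW (hj hv))
    · simp [Finset.disjoint_left]
end

section
/- Let V be a finite type, n : ℕ, and e : Fin n → Finset V with e j nonempty for every j. For I : Finset (V ⊕ Fin n) define F(I) = I ∪ {Sum.inr j | ∀ v ∈ e j, Sum.inl v ∈ I}. Then for every I : Finset (V ⊕ Fin n) there exists V'' : Finset V such that the initial set I' = V''.image Sum.inl satisfies I'.card ≤ I.card and (F(I')).card ≥ (F(I)).card. That is, an initial failure set consisting only of b-type (vertex) entities is always at least as effective. -/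
/-- A set of `S` vertices and `A` edges can be replaced by a set of at most `#S + #A` vertices
without decreasing the number of vertices and covered or chosen edges: each chosen edge that is
not contained in `S` is exchanged for one of its vertices outside `S`. -/
lemma exists_vertices_exchange_edges {V ι : Type*} [DecidableEq V] [Fintype ι] [DecidableEq ι]
    (e : ι → Finset V) (A : Finset ι) (S : Finset V) :
    ∃ W : Finset V, W.card ≤ S.card + A.card ∧
      S.card + (A ∪ Finset.univ.filter (fun j => e j ⊆ S)).card ≤
        W.card + (Finset.univ.filter (fun j => e j ⊆ W)).card := by
  induction A using Finset.induction_on generalizing S with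
  | empty => exact ⟨S, by simp, by simp⟩
  | insert j A hj ih =>
    rw [Finset.card_insert_of_notMem hj, Finset.insert_union]
    by_cases h : e j ⊆ S
    · obtain ⟨W, hW, hcard⟩ := ih S
      refine ⟨W, by omega, ?_⟩
      rwa [Finset.insert_eq_of_mem (by simp [h])]
    · obtain ⟨v, -, hv⟩ := Finset.not_subset.mp h
      obtain ⟨W, hW, hcard⟩ := ih (insert v S)
      rw [Finset.card_insert_of_notMem hv] at hW hcard
      refine ⟨W, by omega, ?_⟩
      have hmono : (A ∪ Finset.univ.filter (fun i => e i ⊆ S)).card ≤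
          (A ∪ Finset.univ.filter (fun i => e i ⊆ insert v S)).card := by
        refine Finset.card_le_card (Finset.union_subset_union_right ?_)
        exact Finset.monotone_filter_right _ fun i _ hi => hi.trans (Finset.subset_insert v S)
      have := Finset.card_insert_le j (A ∪ Finset.univ.filter (fun i => e i ⊆ S))
      omega

lemma caseIIIFail_disjSum {V : Type*} [DecidableEq V] {n : ℕ} (e : Fin n → Finset V)
    (S : Finset V) (A : Finset (Fin n)) :
    caseIIIFail e (S.disjSum A) =
      S.disjSum (A ∪ Finset.univ.filter (fun j => e j ⊆ S)) := by
  ext (v | j) <;> simp [caseIIIFail, Finset.subset_iff]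

/-- In the Case III reduction, an initial failure set consisting only of `b`-type
(vertex) entities is always at least as effective. -/
theorem caseIII_bType_suffices {V : Type*} [Fintype V] [DecidableEq V] (n : ℕ)
    (e : Fin n → Finset V) (he : ∀ j : Fin n, (e j).Nonempty)
    (I : Finset (V ⊕ Fin n)) :
    ∃ V'' : Finset V, (V''.image (Sum.inl : V → V ⊕ Fin n)).card ≤ I.card ∧
      (caseIIIFail e I).card ≤ (caseIIIFail e (V''.image Sum.inl)).card := by
  obtain ⟨W, hW, hcard⟩ := exists_vertices_exchange_edges e I.toRight I.toLeft
  have himage : W.image (Sum.inl : V → V ⊕ Fin n) = W.disjSum ∅ := by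
    ext (v | j) <;> simp
  refine ⟨W, ?_, ?_⟩
  · rwa [himage, Finset.card_disjSum, Finset.card_empty, add_zero,
      ← Finset.card_toLeft_add_card_toRight]
  · rw [himage, ← Finset.toLeft_disjSum_toRight (u := I), caseIIIFail_disjSum,
      caseIIIFail_disjSum, Finset.card_disjSum, Finset.card_disjSum, Finset.empty_union]
    exact hcard
end
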